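/- If non(ℳ) > non(𝒩) or cov*(𝒩) = cof(𝒩), then there is no translation invariant Borel hull operation on ℳ with respect to ℳ. -/

import Mathlib

open MeasureTheory Cardinal Pointwise

/-- `non(ℐ)`: the least cardinality of a set not in the ideal `I`. -/
noncomputable def idealNon {X : Type*} (I : Set (Set X)) : Cardinal :=
  sInf {c : Cardinal | ∃ A : Set X, A ∉ I ∧ #A = c}

/-- `cof(ℐ)`: the least cardinality of a family `F ⊆ I` cofinal in `I` under inclusion. -/
noncomputable def idealCof {X : Type*} (I : Set (Set X)) : Cardinal :=
  sInf {c : Cardinal | ∃ F : Set (Set X), F ⊆ I ∧ (∀ A ∈ I, ∃ B ∈ F, A ⊆ B) ∧ #F = c}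

/-- `cov*(ℐ)`: the least cardinality of a set `A` such that `A + B = ℝⁿ` for some `B ∈ I`. -/
noncomputable def idealCovStar {X : Type*} [Add X] (I : Set (Set X)) : Cardinal :=
  sInf {c : Cardinal | ∃ A : Set X, (∃ B ∈ I, A + B = Set.univ) ∧ #A = c}

/-- A Haar-measurable set that is invariant under a dense set of translations is null or conull. -/
theorem measure_eq_zero_or_compl_of_dense_preimage_add_eq {V : Type*} [NormedAddCommGroup V]
    [NormedSpace ℝ V] [FiniteDimensional ℝ V] [MeasurableSpace V] [BorelSpace V]
    (μ : Measure V) [μ.IsAddHaarMeasure] {G B : Set V} (hG : Dense G) (hB : MeasurableSet B)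
    (hinv : ∀ g ∈ G, (g + ·) ⁻¹' B = B) : μ B = 0 ∨ μ Bᶜ = 0 := by
  by_contra! hcon
  obtain ⟨hB0, hC0⟩ := hcon
  obtain ⟨F, hF, hFC, hF0, hFtop⟩ :=
    Measure.exists_subset_measure_lt_top hB.compl (pos_iff_ne_zero.2 hC0)
  have hnull : ∀ x : V, μ ((x + ·) ⁻¹' F ∩ B) = 0 := by
    intro x
    by_contra hx
    let f : C(V × V, V) := ⟨fun p ↦ p.1 + p.2, by fun_prop⟩
    have ht := tendsto_measure_symmDiff_preimage_nhds_zero (μ := μ) (ν := μ)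
      (f.curry.continuous.tendsto x)
      (.of_forall fun y ↦ measurePreserving_add_left μ y) (measurePreserving_add_left μ x)
      hF.nullMeasurableSet hFtop.ne
    have hev := ht.eventually (gt_mem_nhds (pos_iff_ne_zero.2 hx))
    obtain ⟨g, hgG, hg⟩ := hG.inter_nhds_nonempty hev
    have hsub : (x + ·) ⁻¹' F ∩ B ⊆ symmDiff (f.curry g ⁻¹' F) (f.curry x ⁻¹' F) := by
      rintro y ⟨hyF, hyB⟩
      refine Or.inr ⟨hyF, fun hy ↦ hFC hy ?_⟩
      have : y ∈ (g + ·) ⁻¹' B := by rwa [hinv g hgG]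
      exact this
    exact absurd (measure_mono hsub) (not_le.2 hg)
  have hT : MeasurableSet {p : V × V | p.1 + p.2 ∈ F ∧ p.2 ∈ B} :=
    ((measurable_fst.add measurable_snd) hF).inter (measurable_snd hB)
  have hT0 : (μ.prod μ) {p : V × V | p.1 + p.2 ∈ F ∧ p.2 ∈ B} = 0 :=
    (Measure.measure_prod_null hT).2 (.of_forall hnull)
  rw [Measure.prod_apply_symm hT, lintegral_eq_zero_iff (measurable_measure_prodMk_right hT)] at hT0
  refine hB0 (measure_mono_null (fun y hy ↦ ?_) hT0)
  intro h0
  refine hF0.ne' ?_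
  rw [← measure_preimage_add_right μ y F]
  refine measure_mono_null (t := {x | x + y ∈ F ∧ y ∈ B}) (fun x hx ↦ ?_) h0
  exact ⟨hx, hy⟩

/-- A Borel set containing a dense non-null set `G` and invariant under translations by `G` is not
meagre. -/
theorem not_isMeagre_of_dense_preimage_add_eq {V : Type*} [NormedAddCommGroup V]
    [NormedSpace ℝ V] [FiniteDimensional ℝ V] [MeasurableSpace V] [BorelSpace V]
    (μ : Measure V) [μ.IsAddHaarMeasure] {G B : Set V} (hG : Dense G) (hG0 : μ G ≠ 0)
    (hB : MeasurableSet B) (hGB : G ⊆ B) (hinv : ∀ g ∈ G, (g + ·) ⁻¹' B = B) : ¬ IsMeagre B := by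
  intro hBm
  have : CompleteSpace V := FiniteDimensional.complete ℝ V
  rcases measure_eq_zero_or_compl_of_dense_preimage_add_eq μ hG hB hinv with h | h
  · exact hG0 (measure_mono_null hGB h)
  · obtain ⟨x, hx⟩ : Bᶜ.Nonempty :=
      nonempty_of_not_isMeagre (not_isMeagre_of_mem_residual hBm)
    refine hG0 (measure_mono_null (fun g hg ↦ ?_) ((measure_preimage_add_right μ x Bᶜ).trans h))
    intro hgx
    have : x ∈ (g + ·) ⁻¹' B := hgx
    rw [hinv g hg] at this
    exact hx this

theorem mk_span_rat_le {V : Type*} [AddCommGroup V] [Module ℚ V] (S : Set V) :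
    #(Submodule.span ℚ S) ≤ max #S ℵ₀ := by
  have hr : ((Submodule.span ℚ S : Submodule ℚ V) : Set V) =
      Set.range (Finsupp.linearCombination ℚ ((↑) : S → V)) := by
    rw [← LinearMap.coe_range, Finsupp.range_linearCombination, Subtype.range_coe]
  calc #(Submodule.span ℚ S) = #(Set.range (Finsupp.linearCombination ℚ ((↑) : S → V))) :=
        congrArg (fun s : Set V ↦ #s) hr
    _ ≤ max #S ℵ₀ := by
        refine mk_range_le.trans ?_
        rcases isEmpty_or_nonempty S with hS | hS
        · simp
        · simp [mk_finsupp_lift_of_infinite']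

theorem isMeagre_of_countable {V : Type*} [NormedAddCommGroup V]
    [NormedSpace ℝ V] [FiniteDimensional ℝ V] [Nontrivial V] {S : Set V} (hS : S.Countable) :
    IsMeagre S := by
  borelize V
  rw [← Set.biUnion_of_singleton S]
  exact isMeagre_biUnion hS fun x _ ↦
    .of_isSigmaCompact_null (μ := Measure.addHaar) isCompact_singleton.isSigmaCompact
      (measure_singleton x)

/-- There is a comeagre null set closed under multiplication by nonzero rationals. -/
theorem exists_residual_null_smul_mem {V : Type*} [NormedAddCommGroup V]
    [NormedSpace ℝ V] [FiniteDimensional ℝ V] [Nontrivial V] [Module ℚ V]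
    [MeasurableSpace V] [BorelSpace V] (μ : Measure V) [μ.IsAddHaarMeasure] :
    ∃ C ∈ residual V, μ C = 0 ∧ ∀ q : ℚ, q ≠ 0 → ∀ x ∈ C, q • x ∈ C := by
  have hD0 : μ (Set.range (TopologicalSpace.denseSeq V)) = 0 :=
    (Set.countable_range _).measure_zero μ
  obtain ⟨u, -, hu0, hu⟩ := exists_seq_strictAnti_tendsto' (show (0 : ENNReal) < 1 by simp)
  choose U hDU hUo hUμ using fun k : ℕ ↦
    (Set.range (TopologicalSpace.denseSeq V)).exists_isOpen_le_add μ (hu0 k).1.ne'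
  simp only [hD0, zero_add] at hUμ
  have hres : (⋂ k, U k) ∈ residual V :=
    countable_iInter_mem.2 fun k ↦ residual_of_dense_open (hUo k)
      ((TopologicalSpace.denseRange_denseSeq V).mono (hDU k))
  have hnull : μ (⋂ k, U k) = 0 :=
    le_antisymm (ge_of_tendsto' hu fun k ↦ (measure_mono (Set.iInter_subset U k)).trans (hUμ k))
      zero_le
  refine ⟨⋃ q : {q : ℚ // q ≠ 0}, ((q : ℚ) : ℝ) • ⋂ k, U k, ?_, ?_, ?_⟩
  · refine Filter.mem_of_superset hres fun x hx ↦ Set.mem_iUnion.2 ⟨⟨1, one_ne_zero⟩, ?_⟩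
    simpa using hx
  · refine measure_iUnion_null fun q ↦ ?_
    rw [Measure.addHaar_smul, hnull, mul_zero]
  · intro q hq x hx
    obtain ⟨r, y, hy, rfl⟩ := Set.mem_iUnion.1 hx
    refine Set.mem_iUnion.2 ⟨⟨q * r, mul_ne_zero hq r.2⟩, y, hy, ?_⟩
    simp only [Rat.cast_mul, mul_smul]
    exact Rat.cast_smul_eq_qsmul ℝ q _

/-- Transfinite recursion: values can be chosen subject to a condition on the earlier ones. -/
theorem exists_forall_image_Iio {W V : Type*} [LinearOrder W] [WellFoundedLT W]
    {P : W → Set V → V → Prop} (h : ∀ a S, ∃ x, P a S x) :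
    ∃ g : W → V, ∀ a, P a (g '' Set.Iio a) (g a) := by
  choose p hp using h
  let g : W → V := wellFounded_lt.fix fun a f ↦ p a (Set.range fun b : Set.Iio a ↦ f b b.2)
  refine ⟨g, fun a ↦ ?_⟩
  have hg : g a = p a (g '' Set.Iio a) := by
    rw [Set.image_eq_range]
    exact wellFounded_lt.fix_eq _ a
  rw [hg]
  exact hp _ _

/-- If `C` is closed under nonzero scaling and each `g a` avoids translates of `C` by the span of
`D` and the earlier values, then the span of `D` and all values meets `C` only in the span
of `D`. -/
theorem span_union_range_inter_subset {W K V : Type*} [LinearOrder W] [Field K] [AddCommGroup V]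
    [Module K V] {C D : Set V} (hC : ∀ q : K, q ≠ 0 → ∀ x ∈ C, q • x ∈ C) {g : W → V}
    (hg : ∀ a, g a ∉ C + (Submodule.span K (D ∪ g '' Set.Iio a) : Set V)) :
    (Submodule.span K (D ∪ Set.range g) : Set V) ∩ C ⊆ Submodule.span K D := by
  rintro x ⟨hx, hxC⟩
  rw [SetLike.mem_coe, Submodule.span_union, Submodule.mem_sup] at hx
  obtain ⟨d, hd, y, hy, rfl⟩ := hx
  obtain ⟨c, rfl⟩ := Finsupp.mem_span_range_iff_exists_finsupp.1 hy
  rcases c.support.eq_empty_or_nonempty with h0 | hne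
  · rw [Finsupp.support_eq_empty] at h0
    simpa [h0] using hd
  set a := c.support.max' hne
  have haS : a ∈ c.support := c.support.max'_mem hne
  have hca : c a ≠ 0 := Finsupp.mem_support_iff.1 haS
  set S := Submodule.span K (D ∪ g '' Set.Iio a)
  have hrest : d + ∑ b ∈ c.support.erase a, c b • g b ∈ S := by
    refine add_mem (Submodule.span_mono Set.subset_union_left hd) (sum_mem fun b hb ↦ ?_)
    refine S.smul_mem _ (Submodule.subset_span (Or.inr ⟨b, ?_, rfl⟩))
    exact lt_of_le_of_ne (c.support.le_max' b (Finset.mem_of_mem_erase hb))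
      (Finset.ne_of_mem_erase hb)
  refine absurd ?_ (hg a)
  refine ⟨_, hC (c a)⁻¹ (inv_ne_zero hca) _ hxC, _, S.neg_mem (S.smul_mem (c a)⁻¹ hrest), ?_⟩
  rw [Finsupp.sum, ← Finset.add_sum_erase _ _ haS]
  simp only [smul_add, smul_smul, inv_mul_cancel₀ hca, one_smul]
  abel

/-- A dense rational subspace that is meagre but not null, when `non(𝒩) < non(ℳ)`. -/
theorem exists_dense_meagre_not_null_of_idealNon_lt {V : Type*} [NormedAddCommGroup V]
    [NormedSpace ℝ V] [FiniteDimensional ℝ V] [Nontrivial V] [Module ℚ V]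
    [MeasurableSpace V] [BorelSpace V] (μ : Measure V) [μ.IsAddHaarMeasure]
    (h : idealNon {A : Set V | μ A = 0} < idealNon {A : Set V | IsMeagre A}) :
    ∃ G : Submodule ℚ V, Dense (G : Set V) ∧ IsMeagre (G : Set V) ∧ μ (G : Set V) ≠ 0 := by
  obtain ⟨H, hH, hHc⟩ : idealNon {A : Set V | μ A = 0} ∈
      {c : Cardinal | ∃ A : Set V, A ∉ {A : Set V | μ A = 0} ∧ #A = c} :=
    csInf_mem ⟨_, Set.univ, Measure.measure_univ_ne_zero.2 (NeZero.ne μ), rfl⟩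
  have hHi : ℵ₀ < #H := by
    rw [← not_le, Cardinal.le_aleph0_iff_set_countable]
    exact fun hc ↦ hH (hc.measure_zero μ)
  refine ⟨Submodule.span ℚ (Set.range (TopologicalSpace.denseSeq V) ∪ H),
    (TopologicalSpace.denseRange_denseSeq V).mono
      (Set.subset_union_left.trans Submodule.subset_span), ?_,
    fun h0 ↦ hH (measure_mono_null (Set.subset_union_right.trans Submodule.subset_span) h0)⟩
  by_contra hm
  refine absurd (csInf_le' ⟨_, hm, rfl⟩ : idealNon {A : Set V | IsMeagre A} ≤ _) (not_le.2 ?_)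
  refine lt_of_le_of_lt ?_ h
  rw [← hHc]
  refine (mk_span_rat_le _).trans (max_le ((mk_union_le _ _).trans ?_) hHi.le)
  refine (add_le_max _ _).trans (max_le (max_le ?_ le_rfl) hHi.le)
  exact (Cardinal.le_aleph0_iff_set_countable.2 (Set.countable_range _)).trans hHi.le

/-- A dense rational subspace that is meagre but not null, when `cov*(𝒩) = cof(𝒩)`. -/
theorem exists_dense_meagre_not_null_of_idealCovStar_eq {V : Type*} [NormedAddCommGroup V]
    [NormedSpace ℝ V] [FiniteDimensional ℝ V] [Nontrivial V] [Module ℚ V]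
    [MeasurableSpace V] [BorelSpace V] (μ : Measure V) [μ.IsAddHaarMeasure]
    (h : idealCovStar {A : Set V | μ A = 0} = idealCof {A : Set V | μ A = 0}) :
    ∃ G : Submodule ℚ V, Dense (G : Set V) ∧ IsMeagre (G : Set V) ∧ μ (G : Set V) ≠ 0 := by
  obtain ⟨F, hF, hcof, hFc⟩ : idealCof {A : Set V | μ A = 0} ∈
      {c : Cardinal | ∃ F : Set (Set V), F ⊆ {A : Set V | μ A = 0} ∧
        (∀ A ∈ {A : Set V | μ A = 0}, ∃ B ∈ F, A ⊆ B) ∧ #F = c} :=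
    csInf_mem ⟨_, _, subset_rfl, fun A hA ↦ ⟨A, hA, subset_rfl⟩, rfl⟩
  rw [← h] at hFc
  have hcov : ∀ {A B : Set V}, μ B = 0 → #A < #F → ∃ x, x ∉ B + A := by
    intro A B hB hA
    by_contra! hall
    refine absurd (csInf_le' ⟨A, ⟨B, hB, ?_⟩, rfl⟩ : idealCovStar {A : Set V | μ A = 0} ≤ #A)
      (not_le.2 (hA.trans_eq hFc))
    rw [add_comm]
    exact Set.eq_univ_of_forall hall
  have hFi : ℵ₀ < #F := by
    rw [hFc]
    obtain ⟨A, ⟨B, hB, hAB⟩, hAc⟩ : idealCovStar {A : Set V | μ A = 0} ∈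
        {c : Cardinal | ∃ A : Set V, (∃ B ∈ {A : Set V | μ A = 0}, A + B = Set.univ) ∧ #A = c} :=
      csInf_mem ⟨_, Set.univ, ⟨{0}, measure_singleton 0, by simp⟩, rfl⟩
    rw [← hAc, ← not_le, Cardinal.le_aleph0_iff_set_countable]
    intro hA
    refine NeZero.ne μ (Measure.measure_univ_eq_zero.1 ?_)
    rw [← hAB, ← Set.iUnion_add_left_image]
    refine (measure_biUnion_null_iff hA).2 fun a _ ↦ ?_
    rw [Set.image_add_left, measure_preimage_add]
    exact hB
  obtain ⟨C, hCres, hC0, hCs⟩ := exists_residual_null_smul_mem μ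
  set D := Set.range (TopologicalSpace.denseSeq V)
  have hDc : #D ≤ ℵ₀ := Cardinal.le_aleph0_iff_set_countable.2 (Set.countable_range _)
  obtain ⟨e⟩ : Nonempty ((#F).ord.ToType ≃ F) := Cardinal.eq.1 (mk_ord_toType _)
  obtain ⟨g, hg⟩ := exists_forall_image_Iio
    (P := fun a S x ↦ #S < #F → x ∉ (C ∪ (e a : Set V)) + (Submodule.span ℚ (D ∪ S) : Set V))
    (fun a S ↦ by
      by_cases hS : #S < #F
      · have hspan : #(Submodule.span ℚ (D ∪ S)) < #F :=
          (mk_span_rat_le _).trans_lt (max_lt ((mk_union_le _ _).trans_lt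
            (add_lt_of_lt hFi.le (hDc.trans_lt hFi) hS)) hFi)
        obtain ⟨x, hx⟩ := hcov (measure_union_null hC0 (hF (e a).2)) hspan
        exact ⟨x, fun _ ↦ hx⟩
      · exact ⟨0, fun h ↦ absurd h hS⟩)
  replace hg := fun a ↦ hg a (mk_image_le.trans_lt (by simpa using mk_Iio_lt a))
  refine ⟨Submodule.span ℚ (D ∪ Set.range g), (TopologicalSpace.denseRange_denseSeq V).mono
      (Set.subset_union_left.trans Submodule.subset_span), ?_, fun h0 ↦ ?_⟩
  · have hsub := span_union_range_inter_subset (D := D) hCs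
      fun a hx ↦ hg a (Set.add_subset_add_right Set.subset_union_left hx)
    have hCm : IsMeagre Cᶜ := by rwa [IsMeagre, compl_compl]
    refine ((isMeagre_of_countable (S := Submodule.span ℚ D) ?_).union hCm).mono fun x hx ↦ ?_
    · rw [← Cardinal.le_aleph0_iff_set_countable]
      exact (mk_span_rat_le D).trans (max_le hDc le_rfl)
    · by_cases hxC : x ∈ C
      · exact Or.inl (hsub ⟨hx, hxC⟩)
      · exact Or.inr hxC
  · obtain ⟨N, hN, hGN⟩ := hcof _ h0
    obtain ⟨a, ha⟩ := e.surjective ⟨N, hN⟩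
    refine hg a ⟨g a, Or.inr ?_, 0, zero_mem _, add_zero _⟩
    rw [ha]
    exact hGN (Submodule.subset_span (Or.inr ⟨a, rfl⟩))

/-- If `non(ℳ) > non(𝒩)` or `cov*(𝒩) = cof(𝒩)`, then there is no translation invariant
Borel hull operation on `ℳ` with respect to `ℳ`. -/
theorem no_translation_invariant_hull_on_meager_of_cardinals (n : ℕ) (hn : 1 ≤ n)
    (h : idealNon {A : Set (Fin n → ℝ) | IsMeagre A} >
        idealNon {A : Set (Fin n → ℝ) | volume A = 0} ∨
      idealCovStar {A : Set (Fin n → ℝ) | volume A = 0} =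
        idealCof {A : Set (Fin n → ℝ) | volume A = 0}) :
    ¬ ∃ ψ : Set (Fin n → ℝ) → Set (Fin n → ℝ),
      (∀ A : Set (Fin n → ℝ), IsMeagre A →
        MeasurableSet (ψ A) ∧ A ⊆ ψ A ∧ IsMeagre (ψ A \ A)) ∧
      (∀ A : Set (Fin n → ℝ), IsMeagre A → ∀ x : Fin n → ℝ,
        ψ ((· + x) '' A) = (· + x) '' ψ A) := by
  have : Nonempty (Fin n) := ⟨⟨0, hn⟩⟩
  rintro ⟨ψ, hψ, hinv⟩
  obtain ⟨G, hGd, hGm, hG0⟩ : ∃ G : Submodule ℚ (Fin n → ℝ), Dense (G : Set (Fin n → ℝ)) ∧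
      IsMeagre (G : Set (Fin n → ℝ)) ∧ volume (G : Set (Fin n → ℝ)) ≠ 0 :=
    h.elim (exists_dense_meagre_not_null_of_idealNon_lt volume)
      (exists_dense_meagre_not_null_of_idealCovStar_eq volume)
  obtain ⟨hmeas, hsub, hdiff⟩ := hψ _ hGm
  refine not_isMeagre_of_dense_preimage_add_eq volume hGd hG0 hmeas hsub (fun g hg ↦ ?_)
    ((hGm.union hdiff).mono (by simp))
  have hGg : (· + -g) '' (G : Set (Fin n → ℝ)) = G := by
    ext x
    simp only [Set.image_add_right, neg_neg, Set.mem_preimage, SetLike.mem_coe]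
    exact G.add_mem_iff_left hg
  have := hinv _ hGm (-g)
  rw [hGg, Set.image_add_right, neg_neg] at this
  simpa only [add_comm g] using this.symm
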